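/- arXiv:1202.3320 — 9 statements merged into one kernel-verified Lean document; each statement's English description precedes it below -/
import Mathlib

section
/- If q : Λ → ℝ is a stationary point of the φ⁴ potential V (i.e. all partial derivatives of V vanish at q), then V(q) = −(λ/24) Σ_{k∈Λ} q_k⁴, for all real parameters λ, μ², J. -/
open scoped BigOperators

/-- The four unit shifts (±1,0), (0,±1) on the periodic lattice `ZMod L × ZMod L`,
listed with multiplicity. -/
def shifts (L : ℕ) : List (ZMod L × ZMod L) := [(1, 0), (-1, 0), (0, 1), (0, -1)]

/-- The φ⁴ potential on the periodic `L × L` square lattice (real configurations). -/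
noncomputable def phi4V (L : ℕ) [NeZero L] (lam mu2 J : ℝ) (q : ZMod L × ZMod L → ℝ) : ℝ :=
  ∑ i : ZMod L × ZMod L,
    (lam / 24 * q i ^ 4 - mu2 / 2 * q i ^ 2
      + J / 4 * ((shifts L).map (fun d => (q i - q (i + d)) ^ 2)).sum)

/-- The partial derivative ∂V/∂q_k of the φ⁴ potential (real configurations). -/
noncomputable def phi4Grad (L : ℕ) (lam mu2 J : ℝ) (q : ZMod L × ZMod L → ℝ)
    (k : ZMod L × ZMod L) : ℝ :=
  lam / 6 * q k ^ 3 - mu2 * q k + J * ((shifts L).map (fun d => q k - q (k + d))).sum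

/-- The Hessian of the φ⁴ potential: the matrix of second partial derivatives,
`H k l = ∂/∂q_l (∂V/∂q_k)` (real configurations). -/
noncomputable def phi4Hess (L : ℕ) [NeZero L] (lam mu2 J : ℝ)
    (q : ZMod L × ZMod L → ℝ) : Matrix (ZMod L × ZMod L) (ZMod L × ZMod L) ℝ :=
  Matrix.of fun k l =>
    fderiv ℝ (fun p : ZMod L × ZMod L → ℝ => phi4Grad L lam mu2 J p k) q (Pi.single l 1)

/-- The φ⁴ potential on the periodic `L × L` square lattice (complex configurations). -/
noncomputable def phi4VC (L : ℕ) [NeZero L] (lam mu2 J : ℂ) (q : ZMod L × ZMod L → ℂ) : ℂ :=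
  ∑ i : ZMod L × ZMod L,
    (lam / 24 * q i ^ 4 - mu2 / 2 * q i ^ 2
      + J / 4 * ((shifts L).map (fun d => (q i - q (i + d)) ^ 2)).sum)

/-- The partial derivative ∂V/∂q_k of the φ⁴ potential (complex configurations). -/
noncomputable def phi4GradC (L : ℕ) (lam mu2 J : ℂ) (q : ZMod L × ZMod L → ℂ)
    (k : ZMod L × ZMod L) : ℂ :=
  lam / 6 * q k ^ 3 - mu2 * q k + J * ((shifts L).map (fun d => q k - q (k + d))).sum

/-- The Hessian of the φ⁴ potential (complex configurations). -/
noncomputable def phi4HessC (L : ℕ) [NeZero L] (lam mu2 J : ℂ)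
    (q : ZMod L × ZMod L → ℂ) : Matrix (ZMod L × ZMod L) (ZMod L × ZMod L) ℂ :=
  Matrix.of fun k l =>
    fderiv ℂ (fun p : ZMod L × ZMod L → ℂ => phi4GradC L lam mu2 J p k) q (Pi.single l 1)

/-- at every stationary point, V(q) = −(λ/24) Σ_k q_k⁴. -/
theorem phi4_stationary_value (L : ℕ) [NeZero L] (hL : 2 ≤ L) (lam mu2 J : ℝ)
    (q : ZMod L × ZMod L → ℝ) (hq : ∀ k, phi4Grad L lam mu2 J q k = 0) :
    phi4V L lam mu2 J q = -(lam / 24) * ∑ k : ZMod L × ZMod L, q k ^ 4 := by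
  have hs : ∀ d : ZMod L × ZMod L, ∑ i, q (i + d) ^ 2 = ∑ i, q i ^ 2 := fun d =>
    Equiv.sum_comp (Equiv.addRight d) (fun i => q i ^ 2)
  have key : phi4V L lam mu2 J q = ∑ i : ZMod L × ZMod L,
      (-(lam / 24) * q i ^ 4 + J / 4 * (q (i + (1, 0)) ^ 2 - q i ^ 2)
        + J / 4 * (q (i + (-1, 0)) ^ 2 - q i ^ 2) + J / 4 * (q (i + (0, 1)) ^ 2 - q i ^ 2)
        + J / 4 * (q (i + (0, -1)) ^ 2 - q i ^ 2)) := by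
    unfold phi4V
    refine Finset.sum_congr rfl fun i _ => ?_
    have h := hq i
    simp only [phi4Grad, shifts, List.map_cons, List.map_nil, List.sum_cons, List.sum_nil] at h ⊢
    linear_combination (q i / 2) * h
  rw [key]
  simp only [Finset.sum_add_distrib, ← Finset.mul_sum, Finset.sum_sub_distrib, hs]
  ring
end

section
/- If λ > 0, then for all real parameters μ² and J, every real stationary point q of the φ⁴ potential V satisfies V(q) ≤ 0; in particular, V has no stationary points with positive potential energy. -/
open scoped BigOperators

/-- for λ > 0, every real stationary point has nonpositive potential energy. -/
theorem phi4_stationary_value_nonpos (L : ℕ) [NeZero L] (hL : 2 ≤ L) (lam mu2 J : ℝ)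
    (hlam : 0 < lam) (q : ZMod L × ZMod L → ℝ)
    (hq : ∀ k, phi4Grad L lam mu2 J q k = 0) :
    phi4V L lam mu2 J q ≤ 0 := by
  have hs : ∀ d : ZMod L × ZMod L, ∑ i, q (i + d) ^ 2 = ∑ i, q i ^ 2 := fun d =>
    Equiv.sum_comp (Equiv.addRight d) (fun i => q i ^ 2)
  have key : phi4V L lam mu2 J q = ∑ i : ZMod L × ZMod L, (-(lam / 24) * q i ^ 4
      + J / 4 * (q (i + (1, 0)) ^ 2 + q (i + (-1, 0)) ^ 2 + q (i + (0, 1)) ^ 2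
        + q (i + (0, -1)) ^ 2 - 4 * q i ^ 2)) := by
    unfold phi4V
    refine Finset.sum_congr rfl fun i _ => ?_
    have h := hq i
    simp only [phi4Grad, shifts, List.map_cons, List.map_nil, List.sum_cons, List.sum_nil] at h ⊢
    linear_combination (q i / 2) * h
  rw [key, Finset.sum_add_distrib, ← Finset.mul_sum, ← Finset.mul_sum, Finset.sum_sub_distrib,
    Finset.sum_add_distrib, Finset.sum_add_distrib, Finset.sum_add_distrib, hs, hs, hs, hs,
    ← Finset.mul_sum]
  have h4 : 0 ≤ ∑ i, q i ^ 4 := Finset.sum_nonneg fun i _ => by positivity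
  have := mul_nonneg hlam.le h4
  linarith
end

section
/- Let λ, μ² ∈ ℂ be nonzero and set J = 0. Then every complex stationary point q : Λ → ℂ of the φ⁴ potential V is nonsingular, i.e. the determinant of the Hessian matrix H_V(q) is nonzero. -/
open scoped BigOperators

/-- for nonzero complex λ, μ² and J = 0, every complex stationary point is
nonsingular, i.e. the Hessian determinant is nonzero there. -/
theorem phi4_J_zero_nonsingular (L : ℕ) [NeZero L] (hL : 2 ≤ L) (lam mu2 : ℂ)
    (hlam : lam ≠ 0) (hmu : mu2 ≠ 0) (q : ZMod L × ZMod L → ℂ)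
    (hq : ∀ k, phi4GradC L lam mu2 0 q k = 0) :
    (phi4HessC L lam mu2 0 q).det ≠ 0 := by
  have hH : phi4HessC L lam mu2 0 q
      = Matrix.diagonal (fun k => lam / 2 * q k ^ 2 - mu2) := by
    ext k l
    have h1 : HasFDerivAt (fun p : ZMod L × ZMod L → ℂ => p k)
        (ContinuousLinearMap.proj (R := ℂ) (φ := fun _ : ZMod L × ZMod L => ℂ) k) q :=
      (ContinuousLinearMap.proj (R := ℂ) (φ := fun _ : ZMod L × ZMod L => ℂ) k).hasFDerivAt
    have h0 : HasDerivAt (fun z : ℂ => lam / 6 * z ^ 3 - mu2 * z)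
        (lam / 2 * q k ^ 2 - mu2) (q k) := by
      have := ((hasDerivAt_pow 3 (q k)).const_mul (lam / 6)).sub
        ((hasDerivAt_id (q k)).const_mul mu2)
      refine this.congr_deriv ?_
      push_cast
      ring
    have h2 := HasDerivAt.comp_hasFDerivAt q h0 h1
    have h3 : (fun p : ZMod L × ZMod L → ℂ => phi4GradC L lam mu2 0 p k)
        = (fun z : ℂ => lam / 6 * z ^ 3 - mu2 * z) ∘ (fun p => p k) := by
      funext p
      simp [phi4GradC]
    simp only [phi4HessC, Matrix.of_apply]
    rw [h3, h2.fderiv]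
    by_cases h : k = l
    · subst h
      simp
    · simp [Matrix.diagonal_apply_ne _ h, Pi.single_eq_of_ne h]
  rw [hH, Matrix.det_diagonal]
  refine Finset.prod_ne_zero_iff.mpr fun k _ h => ?_
  have hk := hq k
  simp only [phi4GradC, zero_mul, add_zero] at hk
  have h4 : mu2 * q k = 0 := by linear_combination (q k * h - 3 * hk) / 2
  rcases mul_eq_zero.mp h4 with h5 | h5
  · exact hmu h5
  · rw [h5] at h
    apply hmu
    linear_combination -h
end

section
/- Let λ ∈ ℂ be nonzero. Then for all complex parameters μ² and J, the set of complex stationary points of the φ⁴ potential, {q : Λ → ℂ | ∂V/∂q_k(q) = 0 for all k ∈ Λ}, is finite, and its cardinality is at most 3^N, where N = L². -/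
open scoped BigOperators

/-- monomial evaluation at a point, as a monoid hom in the exponent -/
noncomputable def monoEv {ι : Type} [Fintype ι] (q : ι → ℂ) : Multiplicative (ι → ℕ) →* ℂ where
  toFun m := ∏ k, q k ^ (m.toAdd k)
  map_one' := by simp
  map_mul' a b := by simp [pow_add, Finset.prod_mul_distrib]

theorem monoEv_single {ι : Type} [Fintype ι] [DecidableEq ι] (q : ι → ℂ) (k : ι) (n : ℕ) :
    monoEv q (Multiplicative.ofAdd (Pi.single k n)) = q k ^ n := by
  change ∏ j, q j ^ ((Pi.single k n : ι → ℕ) j) = _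
  rw [Finset.prod_eq_single k]
  · simp
  · intro j _ hj
    simp [hj]
  · simp

theorem monoEv_add_single {ι : Type} [Fintype ι] [DecidableEq ι] (q : ι → ℂ) (m : ι → ℕ) (k : ι)
    (n : ℕ) : monoEv q (Multiplicative.ofAdd (m + Pi.single k n))
      = monoEv q (Multiplicative.ofAdd m) * q k ^ n := by
  rw [ofAdd_add, map_mul, monoEv_single]

theorem monoEv_injective {ι : Type} [Fintype ι] [DecidableEq ι] :
    Function.Injective (monoEv : (ι → ℂ) → _) := by
  intro p q h
  funext k
  have := DFunLike.congr_fun h (Multiplicative.ofAdd (Pi.single k 1))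
  simpa [monoEv_single] using this

theorem indep_aux {ι : Type} [Fintype ι] [DecidableEq ι] (S : Set (ι → ℂ)) (a : ι → ι → ℂ)
    (hS : ∀ q ∈ S, ∀ k, q k ^ 3 = ∑ j, a k j * q j) :
    LinearIndependent ℂ (fun (q : S) (e : ι → Fin 3) =>
      monoEv q.1 (Multiplicative.ofAdd (fun k => (e k : ℕ)))) := by
  have hli : LinearIndependent ℂ
      (fun q : S => (monoEv q.1 : Multiplicative (ι → ℕ) → ℂ)) :=
    (linearIndependent_monoidHom (Multiplicative (ι → ℕ)) ℂ).comp
      (fun q : S => monoEv q.1) (fun p q h => Subtype.ext (monoEv_injective h))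
  rw [linearIndependent_iff'] at hli ⊢
  intro s c hc
  refine hli s c ?_
  have key : ∀ n : ℕ, ∀ m : ι → ℕ, ∑ k, m k = n →
      ∑ t ∈ s, c t * monoEv t.1 (Multiplicative.ofAdd m) = 0 := by
    intro n
    induction n using Nat.strong_induction_on with
    | _ n ih =>
      intro m hm
      by_cases h : ∀ k, m k < 3
      · have := congrFun hc (fun k => ⟨m k, h k⟩)
        simpa using this
      · push Not at h
        obtain ⟨k, hk⟩ := h
        obtain ⟨m', rfl⟩ : ∃ m' : ι → ℕ, m = m' + (Pi.single k 3 : ι → ℕ) := by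
          refine ⟨m - (Pi.single k 3 : ι → ℕ), ?_⟩
          funext j
          by_cases hj : j = k
          · subst hj; simp; omega
          · simp [hj]
        have hsum : ∀ j r, ∑ i, (m' + Pi.single j r : ι → ℕ) i = ∑ i, m' i + r := by
          intro j r
          simp [Finset.sum_add_distrib]
        have h1 : ∀ j, ∑ t ∈ s, c t * (monoEv t.1 (Multiplicative.ofAdd m') * t.1 j) = 0 := by
          intro j
          have := ih (∑ i, m' i + 1) (by rw [← hm, hsum]; omega) (m' + Pi.single j 1) (hsum j 1)
          simpa only [monoEv_add_single, pow_one] using this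
        calc _ = ∑ t ∈ s, ∑ j, a k j * (c t * (monoEv t.1 (Multiplicative.ofAdd m') * t.1 j)) := by
              refine Finset.sum_congr rfl fun t _ => ?_
              rw [monoEv_add_single, hS t.1 t.2 k, Finset.mul_sum, Finset.mul_sum]
              exact Finset.sum_congr rfl fun j _ => by ring
          _ = 0 := by
              rw [Finset.sum_comm]
              simp [← Finset.mul_sum, h1]
  funext m
  have := key _ m.toAdd rfl
  simpa using this

/-- for nonzero complex λ and any complex μ², J, the set of complex stationary
points of the φ⁴ potential is finite, with at most 3^N elements. -/
theorem phi4_complex_stationary_points_finite (L : ℕ) [NeZero L] (hL : 2 ≤ L)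
    (lam mu2 J : ℂ) (hlam : lam ≠ 0) :
    {q : ZMod L × ZMod L → ℂ | ∀ k, phi4GradC L lam mu2 J q k = 0}.Finite ∧
    {q : ZMod L × ZMod L → ℂ | ∀ k, phi4GradC L lam mu2 J q k = 0}.ncard ≤ 3 ^ (L ^ 2) := by
  set S := {q : ZMod L × ZMod L → ℂ | ∀ k, phi4GradC L lam mu2 J q k = 0} with hSdef
  have hli := indep_aux S (fun k j => 6 / lam * ((mu2 - 4 * J) * (if j = k then 1 else 0)
      + J * ((if j = k + (1, 0) then 1 else 0) + (if j = k + (-1, 0) then 1 else 0)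
        + (if j = k + (0, 1) then 1 else 0) + (if j = k + (0, -1) then 1 else 0)))) (by
    intro q hq k
    have h := hq k
    simp only [phi4GradC, shifts, List.map_cons, List.map_nil, List.sum_cons, List.sum_nil] at h
    simp only [mul_assoc, ← Finset.mul_sum, add_mul, Finset.sum_add_distrib, ite_mul, one_mul,
      zero_mul, Finset.sum_ite_eq', Finset.sum_ite_eq, Finset.mem_univ, if_true]
    field_simp
    linear_combination 6 * h)
  have hfin : Finite S := hli.finite
  have : Fintype S := Fintype.ofFinite S
  refine ⟨Set.toFinite S, ?_⟩
  have := hli.fintype_card_le_finrank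
  rw [← Nat.card_coe_set_eq, Nat.card_eq_fintype_card]
  simpa [ZMod.card, sq] using this
end

section
/- (Proposition) For each integer L ≥ 2 and nonzero λ, μ² ∈ ℂ, the set S(L, λ, μ²) = { J ∈ ℂ | there exists a configuration q : Λ → ℂ such that ∂V/∂q_k(q) = 0 for all k ∈ Λ and det H_V(q) = 0 } is a finite subset of ℂ. -/
open scoped BigOperators

theorem aux_finite {R A σ : Type*} [CommRing R] [CommRing A] [Algebra R A] [Fintype σ]
    (f : MvPolynomial σ R →ₐ[R] A) (hf : Function.Surjective f)
    (h : ∀ k, f (MvPolynomial.X k) ^ 3 ∈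
      Submodule.span R (Set.range fun k => f (MvPolynomial.X k))) : Module.Finite R A := by
  classical
  set T : Set (σ →₀ ℕ) := {m | ∀ k, m k ≤ 2} with hT
  have hTfin : T.Finite := by
    refine (Set.finite_Iic (Finsupp.equivFunOnFinite.symm (fun _ : σ => 2))).subset ?_
    intro m hm k
    simpa using hm k
  set N : Submodule R A := Submodule.span R ((fun m => f (MvPolynomial.monomial m 1)) '' T) with hN
  have key : ∀ n : ℕ, ∀ m : σ →₀ ℕ, m.degree = n → f (MvPolynomial.monomial m 1) ∈ N := by
    intro n
    induction n using Nat.strong_induction_on with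
    | _ n ih =>
      intro m hm
      by_cases hmT : m ∈ T
      · exact Submodule.subset_span ⟨m, hmT, rfl⟩
      · simp only [hT, Set.mem_ofPred_eq, not_forall, not_le] at hmT
        obtain ⟨k, hk⟩ := hmT
        have hle : Finsupp.single k 3 ≤ m := by
          rw [Finsupp.single_le_iff]; omega
        obtain ⟨m', rfl⟩ := exists_add_of_le hle
        have e : f (MvPolynomial.monomial (Finsupp.single k 3 + m') 1)
            = f (MvPolynomial.monomial m' 1) * f (MvPolynomial.X k) ^ 3 := by
          rw [← map_pow, ← map_mul, MvPolynomial.X_pow_eq_monomial, MvPolynomial.monomial_mul,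
            add_comm, one_mul]
        rw [e]
        have : ∀ y ∈ Submodule.span R (Set.range fun k => f (MvPolynomial.X k)),
            f (MvPolynomial.monomial m' 1) * y ∈ N := by
          intro y hy
          induction hy using Submodule.span_induction with
          | mem y hy =>
            obtain ⟨l, rfl⟩ := hy
            have e2 : f (MvPolynomial.monomial m' 1) * f (MvPolynomial.X l)
              = f (MvPolynomial.monomial (m' + Finsupp.single l 1) 1) := by
              rw [← map_mul, MvPolynomial.X, MvPolynomial.monomial_mul, one_mul]
            simp only [e2]
            refine ih _ ?_ _ rfl
            rw [← hm]
            simp only [map_add, Finsupp.degree_single]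
            omega
          | zero => simp
          | add a b _ _ ha hb => rw [mul_add]; exact N.add_mem ha hb
          | smul r a _ ha => rw [mul_smul_comm]; exact N.smul_mem r ha
        exact this _ (h k)
  refine ⟨⟨(hTfin.image (fun m => f (MvPolynomial.monomial m 1))).toFinset, ?_⟩⟩
  rw [Set.Finite.coe_toFinset, eq_top_iff]
  rintro a -
  obtain ⟨p, rfl⟩ := hf a
  rw [p.as_sum, map_sum]
  refine Submodule.sum_mem _ fun m _ => ?_
  have : MvPolynomial.monomial m (p.coeff m) = p.coeff m • MvPolynomial.monomial m (1 : R) := by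
    simp [MvPolynomial.smul_monomial]
  rw [this, map_smul]
  exact Submodule.smul_mem _ _ (key _ m rfl)

/-- coupling matrix -/
def cmat (L : ℕ) (k l : ZMod L × ZMod L) : ℂ :=
  ((shifts L).map (fun d => (if k = l then 1 else 0) - (if k + d = l then 1 else 0))).sum

theorem hess_apply (L : ℕ) [NeZero L] (lam mu2 J : ℂ) (q : ZMod L × ZMod L → ℂ)
    (k l : ZMod L × ZMod L) :
    phi4HessC L lam mu2 J q k l =
      (lam / 2 * q k ^ 2 - mu2) * (if k = l then 1 else 0) + J * cmat L k l := by
  have hp : ∀ i : ZMod L × ZMod L, HasFDerivAt (fun p : ZMod L × ZMod L → ℂ => p i)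
      (ContinuousLinearMap.proj (R := ℂ) (φ := fun _ : ZMod L × ZMod L => ℂ) i) q :=
    fun i => hasFDerivAt_apply i q
  have hs : ∀ i, (Pi.single l (1 : ℂ) : ZMod L × ZMod L → ℂ) i = if i = l then 1 else 0 := by
    intro i; rw [Pi.single_apply]
  have H := (((((hp k).pow 3).const_mul (lam / 6)).sub ((hp k).const_mul mu2)).add
    ((((hp k).sub (hp (k + (1, 0)))).add (((hp k).sub (hp (k + (-1, 0)))).add
      (((hp k).sub (hp (k + (0, 1)))).add ((hp k).sub (hp (k + (0, -1))))))).const_mul J))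
  have H2 := (H.congr_of_eventuallyEq (f₁ := fun p => phi4GradC L lam mu2 J p k)
    (Filter.Eventually.of_forall fun p => by
      simp [phi4GradC, shifts])).fderiv
  simp only [phi4HessC, Matrix.of_apply]
  rw [H2]
  by_cases hkl : k = l
  · simp [hs, cmat, shifts, hkl]
    ring
  · simp [hs, cmat, shifts, hkl, -mul_ite, mul_add]

open MvPolynomial in
/-- gradient polynomial -/
noncomputable def gpoly (L : ℕ) (lam mu2 : ℂ) (k : ZMod L × ZMod L) :
    MvPolynomial (ZMod L × ZMod L) (Polynomial ℂ) :=
  C (Polynomial.C (lam / 6)) * X k ^ 3 - C (Polynomial.C mu2) * X k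
    + C Polynomial.X * ((shifts L).map (fun d => X k - X (k + d))).sum

open MvPolynomial in
/-- Hessian matrix of polynomials -/
noncomputable def hmat (L : ℕ) (lam mu2 : ℂ) :
    Matrix (ZMod L × ZMod L) (ZMod L × ZMod L)
      (MvPolynomial (ZMod L × ZMod L) (Polynomial ℂ)) :=
  Matrix.of fun k l =>
    (C (Polynomial.C (lam / 2)) * X k ^ 2 - C (Polynomial.C mu2)) * (if k = l then 1 else 0)
      + C Polynomial.X * C (Polynomial.C (cmat L k l))

/-- the ideal -/
noncomputable def sIdeal (L : ℕ) [NeZero L] (lam mu2 : ℂ) :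
    Ideal (MvPolynomial (ZMod L × ZMod L) (Polynomial ℂ)) :=
  Ideal.span (insert (hmat L lam mu2).det (Set.range (gpoly L lam mu2)))

theorem sIdeal_top (L : ℕ) [NeZero L] (lam mu2 : ℂ) (hlam : lam ≠ 0) (hmu : mu2 ≠ 0) :
    sIdeal L lam mu2 ⊔ Ideal.span {MvPolynomial.C Polynomial.X} = ⊤ := by
  by_contra hne
  obtain ⟨m, hm, hle⟩ := Ideal.exists_le_maximal _ hne
  set K := MvPolynomial (ZMod L × ZMod L) (Polynomial ℂ) ⧸ m
  letI : Field K := Ideal.Quotient.field m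
  set π := Ideal.Quotient.mk m with hπ
  have hX : π (MvPolynomial.C Polynomial.X) = 0 :=
    Ideal.Quotient.eq_zero_iff_mem.2
      (hle ((le_sup_right : _ ≤ sIdeal L lam mu2 ⊔ _) (Ideal.subset_span rfl)))
  have hg : ∀ k, π (gpoly L lam mu2 k) = 0 := fun k =>
    Ideal.Quotient.eq_zero_iff_mem.2
      (hle ((le_sup_left : sIdeal L lam mu2 ≤ _) (Ideal.subset_span (Or.inr ⟨k, rfl⟩))))
  have hh : π (hmat L lam mu2).det = 0 :=
    Ideal.Quotient.eq_zero_iff_mem.2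
      (hle ((le_sup_left : sIdeal L lam mu2 ≤ _) (Ideal.subset_span (Or.inl rfl))))
  let ι : ℂ →+* K := π.comp (MvPolynomial.C.comp Polynomial.C)
  have hι : ∀ c, π (MvPolynomial.C (Polynomial.C c)) = ι c := fun c => rfl
  have hdiag : (hmat L lam mu2).map π =
      Matrix.diagonal fun k => ι (lam / 2) * π (MvPolynomial.X k) ^ 2 - ι mu2 := by
    ext k l
    by_cases hkl : k = l
    · subst hkl; simp [hmat, hX, hι]
    · simp [hmat, hX, hι, hkl]
  rw [RingHom.map_det, RingHom.mapMatrix_apply, hdiag, Matrix.det_diagonal,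
    Finset.prod_eq_zero_iff] at hh
  obtain ⟨k, -, hk⟩ := hh
  have h3 := hg k
  simp only [gpoly, map_add, map_sub, map_mul, map_pow, hX, zero_mul, add_zero, hι] at h3
  set x := π (MvPolynomial.X k)
  have hmu' : ι mu2 ≠ 0 := (map_ne_zero ι).2 hmu
  have e1 : ι (lam / 2) = 3 * ι (lam / 6) := by
    rw [show lam / 2 = 3 * (lam / 6) by ring, map_mul, map_ofNat]
  rw [e1] at hk
  have h2 : (2 : K) ≠ 0 := by
    have := (map_ne_zero ι).2 (two_ne_zero : (2 : ℂ) ≠ 0)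
    rwa [map_ofNat] at this
  have h4 : x * (2 * ι mu2) = 0 := by linear_combination x * hk - 3 * h3
  have hx : x = 0 := by
    rcases mul_eq_zero.1 h4 with h | h
    · exact h
    · exact absurd h (mul_ne_zero h2 hmu')
  rw [hx] at hk
  apply hmu'
  linear_combination -hk

theorem sIdeal_cube (L : ℕ) [NeZero L] (lam mu2 : ℂ) (hlam : lam ≠ 0) (k : ZMod L × ZMod L) :
    ∃ y ∈ Submodule.span (Polynomial ℂ) (Set.range
      (MvPolynomial.X : _ → MvPolynomial (ZMod L × ZMod L) (Polynomial ℂ))),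
      MvPolynomial.X k ^ 3 - y ∈ sIdeal L lam mu2 := by
  set S := Submodule.span (Polynomial ℂ) (Set.range
      (MvPolynomial.X : _ → MvPolynomial (ZMod L × ZMod L) (Polynomial ℂ))) with hS
  have hx : ∀ l, MvPolynomial.X l ∈ S := fun l => Submodule.subset_span ⟨l, rfl⟩
  refine ⟨Polynomial.C (6 / lam) •
      (Polynomial.C mu2 • MvPolynomial.X k - (Polynomial.X : Polynomial ℂ) •
        ((shifts L).map (fun d => MvPolynomial.X k - MvPolynomial.X (k + d))).sum), ?_, ?_⟩
  · refine S.smul_mem _ (S.sub_mem (S.smul_mem _ (hx k)) (S.smul_mem _ ?_))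
    refine list_sum_mem ?_
    intro y hy
    obtain ⟨d, -, rfl⟩ := List.mem_map.1 hy
    exact S.sub_mem (hx _) (hx _)
  · have hg : gpoly L lam mu2 k ∈ sIdeal L lam mu2 := Ideal.subset_span (Or.inr ⟨k, rfl⟩)
    have h1 : (MvPolynomial.C (Polynomial.C (6 / lam)) * MvPolynomial.C (Polynomial.C (lam / 6)) :
        MvPolynomial (ZMod L × ZMod L) (Polynomial ℂ)) = 1 := by
      rw [← map_mul, ← map_mul, show 6 / lam * (lam / 6) = 1 by field_simp, map_one, map_one]
    have := (sIdeal L lam mu2).mul_mem_left (MvPolynomial.C (Polynomial.C (6 / lam))) hg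
    convert this using 1
    simp only [MvPolynomial.smul_eq_C_mul, gpoly]
    linear_combination (-(MvPolynomial.X k) ^ 3) * h1

theorem nak {R A : Type*} [CommRing R] [CommRing A] [Algebra R A] (hfin : Module.Finite R A)
    (t : R) (h : ∀ a : A, ∃ w : A, a = t • w) :
    ∃ r : R, r - 1 ∈ Ideal.span {t} ∧ algebraMap R A r = 0 := by
  obtain ⟨r, hr, hr0⟩ := Submodule.exists_sub_one_mem_and_smul_eq_zero_of_fg_of_le_smul
    (Ideal.span {t}) (⊤ : Submodule R A) hfin.fg_top (by
      rintro a -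
      obtain ⟨w, rfl⟩ := h a
      exact Submodule.smul_mem_smul (Ideal.subset_span rfl) Submodule.mem_top)
  refine ⟨r, hr, ?_⟩
  rw [Algebra.algebraMap_eq_smul_one]
  exact hr0 1 Submodule.mem_top

theorem gen_r0 {R A σ : Type*} [CommRing R] [CommRing A] [Algebra R A] [Fintype σ]
    (f : MvPolynomial σ R →ₐ[R] A) (hf : Function.Surjective f)
    (I : Ideal (MvPolynomial σ R)) (hI : ∀ p, f p = 0 ↔ p ∈ I) (t : R)
    (hc : ∀ k, ∃ y ∈ Submodule.span R (Set.range (MvPolynomial.X : σ → MvPolynomial σ R)),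
      MvPolynomial.X k ^ 3 - y ∈ I)
    (htop : I ⊔ Ideal.span {MvPolynomial.C t} = ⊤) :
    ∃ r : R, r - 1 ∈ Ideal.span {t} ∧ MvPolynomial.C r ∈ I := by
  have hfin : Module.Finite R A := by
    refine aux_finite f hf fun k => ?_
    obtain ⟨y, hy, hyI⟩ := hc k
    have e : f (MvPolynomial.X k) ^ 3 = f y := by
      rw [← map_pow, ← sub_eq_zero, ← map_sub]
      exact (hI _).2 hyI
    rw [e]
    have := Submodule.mem_map_of_mem (f := f.toLinearMap) hy
    rw [Submodule.map_span, ← Set.range_comp] at this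
    exact this
  obtain ⟨r, hr, hr0⟩ := nak hfin t (by
      intro a
      obtain ⟨p, rfl⟩ := hf a
      have hp : p ∈ I ⊔ Ideal.span {MvPolynomial.C t} := by
        rw [htop]; trivial
      obtain ⟨u, hu, v, hv, rfl⟩ := Submodule.mem_sup.1 hp
      obtain ⟨w, rfl⟩ := Ideal.mem_span_singleton.1 hv
      refine ⟨f w, ?_⟩
      rw [map_add, (hI _).2 hu, zero_add, ← MvPolynomial.smul_eq_C_mul, map_smul])
  refine ⟨r, hr, (hI _).1 ?_⟩
  rw [← hr0, ← MvPolynomial.algebraMap_eq]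
  exact f.commutes r

theorem gen_r {R σ : Type*} [CommRing R] [Fintype σ] (I : Ideal (MvPolynomial σ R)) (t : R)
    (hc : ∀ k, ∃ y ∈ Submodule.span R (Set.range (MvPolynomial.X : σ → MvPolynomial σ R)),
      MvPolynomial.X k ^ 3 - y ∈ I)
    (htop : I ⊔ Ideal.span {MvPolynomial.C t} = ⊤) :
    ∃ r : R, r - 1 ∈ Ideal.span {t} ∧ MvPolynomial.C r ∈ I :=
  gen_r0 (Ideal.Quotient.mkₐ R I) (Ideal.Quotient.mkₐ_surjective R I) I
    (fun _ => Ideal.Quotient.eq_zero_iff_mem) t hc htop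

theorem exists_r (L : ℕ) [NeZero L] (lam mu2 : ℂ) (hlam : lam ≠ 0) (hmu : mu2 ≠ 0) :
    ∃ r : Polynomial ℂ, r ≠ 0 ∧ MvPolynomial.C r ∈ sIdeal L lam mu2 := by
  obtain ⟨r, hr, hI⟩ := gen_r (sIdeal L lam mu2) Polynomial.X (sIdeal_cube L lam mu2 hlam)
    (sIdeal_top L lam mu2 hlam hmu)
  refine ⟨r, ?_, hI⟩
  rintro rfl
  obtain ⟨w, hw⟩ := Ideal.mem_span_singleton.1 hr
  have := congrArg (Polynomial.eval 0) hw
  simp at this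

/-- Proposition: for fixed L ≥ 2 and nonzero λ, μ² ∈ ℂ, the set of couplings
J ∈ ℂ for which the φ⁴ model has a singular complex stationary point is finite. -/
theorem phi4_singular_couplings_finite (L : ℕ) [NeZero L] (hL : 2 ≤ L)
    (lam mu2 : ℂ) (hlam : lam ≠ 0) (hmu : mu2 ≠ 0) :
    {J : ℂ | ∃ q : ZMod L × ZMod L → ℂ,
      (∀ k, phi4GradC L lam mu2 J q k = 0) ∧ (phi4HessC L lam mu2 J q).det = 0}.Finite := by
  obtain ⟨r, hr, hrI⟩ := exists_r L lam mu2 hlam hmu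
  refine (r.roots.toFinset.finite_toSet).subset ?_
  rintro J ⟨q, hg, hh⟩
  let ev : MvPolynomial (ZMod L × ZMod L) (Polynomial ℂ) →+* ℂ :=
    MvPolynomial.eval₂Hom (Polynomial.evalRingHom J) q
  have hker : sIdeal L lam mu2 ≤ RingHom.ker ev := by
    refine Ideal.span_le.2 ?_
    rintro p (rfl | ⟨k, rfl⟩)
    · change ev _ = 0
      rw [RingHom.map_det, ← hh]
      congr 1
      ext k l
      rw [hess_apply]
      by_cases hkl : k = l
      · subst hkl; simp [hmat, ev]
      · simp [hmat, ev, hkl]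
    · change ev _ = 0
      rw [← hg k]
      simp [gpoly, phi4GradC, ev, shifts]
  have h0 : ev (MvPolynomial.C r) = 0 := hker hrI
  simp only [ev, MvPolynomial.coe_eval₂Hom, MvPolynomial.eval₂_C, Polynomial.coe_evalRingHom] at h0
  simp [hr, h0]
end

section
/- (Corollary) For nonzero λ, μ² ∈ ℂ, the set T(λ, μ²) = ⋃_{L ≥ 2} S(L, λ, μ²) — the union over all lattice sizes L ≥ 2 of the sets of couplings J for which the L×L φ⁴ model has a singular complex stationary point — is a countable subset of ℂ. -/
open scoped BigOperators

theorem core_valuation {ι : Type*} [Fintype ι] [DecidableEq ι] (V : ValuationSubring ℂ)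
    (lam mu2 J : ℂ) (hlam : lam ∈ V) (hlam' : lam⁻¹ ∈ V) (hmu : mu2 ∈ V) (hmu' : mu2⁻¹ ∈ V)
    (hl0 : lam ≠ 0) (hm0 : mu2 ≠ 0)
    (h6 : (6 : ℂ)⁻¹ ∈ V) (hJ : J ∈ V.nonunits) (N : Matrix ι ι ℤ) (q : ι → ℂ)
    (hq : ∀ k, lam / 6 * q k ^ 3 - mu2 * q k + J * ∑ l, (N k l : ℂ) * q l = 0)
    (hdet : (Matrix.of fun k l : ι => (if k = l then lam / 2 * q k ^ 2 - mu2 else 0)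
      + J * (N k l : ℂ)).det = 0) : False := by
  have hJV : J ∈ V := V.nonunits_subset hJ
  have hne : Nonempty ι := by
    by_contra h
    rw [not_nonempty_iff] at h
    simp [Matrix.det_isEmpty] at hdet
  have hN : ∀ k l, (N k l : ℂ) ∈ V := fun k l => intCast_mem V _
  have h6' : (6 : ℂ) ∈ V := by exact_mod_cast natCast_mem V 6
  have hqV : ∀ k, q k ∈ V := by
    obtain ⟨m, hm⟩ := Finite.exists_max (fun k => V.valuation (q k))
    have hmV : q m ∈ V := by
      by_cases h0 : q m = 0
      · rw [h0]; exact zero_mem V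
      have hr : ∀ l, q l / q m ∈ V := by
        intro l
        rw [← V.valuation_le_one_iff, map_div₀]
        exact div_le_one_of_le₀ (hm l) zero_le
      have h2 : q m ^ 2 = lam⁻¹ * 6 * (mu2 - J * ∑ l, (N m l : ℂ) * (q l / q m)) := by
        have h1 : ∑ l, (N m l : ℂ) * (q l / q m) = (∑ l, (N m l : ℂ) * q l) / q m := by
          rw [Finset.sum_div]
          exact Finset.sum_congr rfl fun l _ => by ring
        rw [h1]
        have := hq m
        field_simp
        linear_combination 6 * this
      have h3 : q m ^ 2 ∈ V := by
        rw [h2]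
        exact mul_mem (mul_mem hlam' h6') (sub_mem hmu (mul_mem hJV
          (sum_mem fun l _ => mul_mem (hN m l) (hr l))))
      rw [← V.valuation_le_one_iff, map_pow] at h3
      rw [← V.valuation_le_one_iff]
      exact (pow_le_one_iff (by norm_num)).1 h3
    intro k
    rw [← V.valuation_le_one_iff] at hmV ⊢
    exact (hm k).trans hmV
  have h2V : (2 : ℂ)⁻¹ ∈ V := by
    have : (2 : ℂ)⁻¹ = 6⁻¹ * 3 := by norm_num
    rw [this]
    exact mul_mem h6 (by exact_mod_cast natCast_mem V 3)
  -- lifts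
  let Q : ι → V := fun k => ⟨q k, hqV k⟩
  let la : V := ⟨lam, hlam⟩
  let mu : V := ⟨mu2, hmu⟩
  let j : V := ⟨J, hJV⟩
  let s : V := ⟨(6 : ℂ)⁻¹, h6⟩
  let t : V := ⟨(2 : ℂ)⁻¹, h2V⟩
  let π := IsLocalRing.residue V
  have hj : π j = 0 := by
    rw [IsLocalRing.residue_eq_zero_iff]
    exact (V.mem_nonunits_iff_exists_mem_maximalIdeal.1 hJ).2
  have hla : π la ≠ 0 := by
    have : la * ⟨lam⁻¹, hlam'⟩ = 1 := Subtype.ext (mul_inv_cancel₀ hl0)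
    intro h
    simpa [h] using congrArg π this
  have hmu1 : π mu ≠ 0 := by
    have : mu * ⟨mu2⁻¹, hmu'⟩ = 1 := Subtype.ext (mul_inv_cancel₀ hm0)
    intro h
    simpa [h] using congrArg π this
  have hs : 6 * π s = 1 := by
    have : 6 * s = 1 := Subtype.ext (mul_inv_cancel₀ (by norm_num : (6 : ℂ) ≠ 0))
    have h := congrArg π this
    rwa [map_mul, map_ofNat, map_one] at h
  have ht : 2 * π t = 1 := by
    have : 2 * t = 1 := Subtype.ext (mul_inv_cancel₀ (by norm_num : (2 : ℂ) ≠ 0))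
    have h := congrArg π this
    rwa [map_mul, map_ofNat, map_one] at h
  have hQ : ∀ k, π la * π s * π (Q k) ^ 3 - π mu * π (Q k) = 0 := by
    intro k
    have : la * s * Q k ^ 3 - mu * Q k + j * ∑ l, (N k l : V) * Q l = 0 := by
      apply Subtype.ext
      have := hq k
      rw [div_eq_mul_inv] at this
      push_cast
      exact this
    simpa [hj] using congrArg π this
  have hD : (Matrix.of fun k l : ι => (if k = l then la * t * Q k ^ 2 - mu else 0)
      + j * (N k l : V)).det = 0 := by
    apply V.subtype_injective
    rw [RingHom.map_det, map_zero, ← hdet]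
    congr 1
    ext k l
    simp only [RingHom.mapMatrix_apply, Matrix.map_apply, Matrix.of_apply, map_add, map_mul,
      map_intCast]
    split_ifs <;> simp [div_eq_mul_inv, la, t, Q, mu, j]
  have hD2 : (Matrix.diagonal fun k : ι => π la * π t * π (Q k) ^ 2 - π mu).det = 0 := by
    have := congrArg π hD
    rw [RingHom.map_det, map_zero] at this
    rw [← this]
    congr 1
    ext k l
    simp only [RingHom.mapMatrix_apply, Matrix.map_apply, Matrix.of_apply, map_add, map_mul, hj,
      Matrix.diagonal_apply]
    split_ifs <;> simp
  rw [Matrix.det_diagonal, Finset.prod_eq_zero_iff] at hD2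
  obtain ⟨k, -, hk⟩ := hD2
  have e := hQ k
  have e1 : π (Q k) * (π la * π s * π (Q k) ^ 2 - π mu) = 0 := by linear_combination e
  rcases mul_eq_zero.1 e1 with h | h
  · rw [h] at hk
    apply hmu1
    linear_combination -hk
  · -- la x^2 = 6 mu, la x^2 = 2 mu
    have a1 : π la * π (Q k) ^ 2 = 6 * π mu := by
      linear_combination 6 * h - π la * π (Q k) ^ 2 * hs
    have a2 : π la * π (Q k) ^ 2 = 2 * π mu := by
      linear_combination 2 * hk - π la * π (Q k) ^ 2 * ht
    apply hmu1
    have a3 : 4 * π mu = 0 := by linear_combination a2 - a1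
    linear_combination (-π mu) * (2 * π t + 1) * ht + π t ^ 2 * a3

theorem core_algebraic {ι : Type*} [Fintype ι] [DecidableEq ι] (K : Subfield ℂ)
    (lam mu2 J : ℂ) (hlam : lam ∈ K) (hmu : mu2 ∈ K)
    (hl0 : lam ≠ 0) (hm0 : mu2 ≠ 0) (N : Matrix ι ι ℤ) (q : ι → ℂ)
    (hq : ∀ k, lam / 6 * q k ^ 3 - mu2 * q k + J * ∑ l, (N k l : ℂ) * q l = 0)
    (hdet : (Matrix.of fun k l : ι => (if k = l then lam / 2 * q k ^ 2 - mu2 else 0)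
      + J * (N k l : ℂ)).det = 0) : IsAlgebraic K J := by
  by_contra hJ
  let A : Subring ℂ := (Algebra.adjoin K {J}).toSubring
  have hJA : J ∈ A := Algebra.subset_adjoin (Set.mem_singleton J)
  have hI : Ideal.span {(⟨J, hJA⟩ : A)} ≠ ⊤ := by
    intro h
    rw [Ideal.eq_top_iff_one, Ideal.mem_span_singleton'] at h
    obtain ⟨⟨a, ha⟩, h⟩ := h
    have h1 : a * J = 1 := congrArg Subtype.val h
    have ha' : a ∈ Algebra.adjoin K {J} := ha
    rw [Algebra.adjoin_singleton_eq_range_aeval] at ha'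
    obtain ⟨p, hp⟩ := ha'
    apply hJ
    refine ⟨p * Polynomial.X - 1, ?_, ?_⟩
    · intro h0
      have := congrArg (Polynomial.eval 0) h0
      simp at this
    · have hp' : Polynomial.aeval J p = a := hp
      simp [hp', h1]
  obtain ⟨V, hAV, hV⟩ := Ideal.image_subset_nonunits_valuationSubring _ hI
  have hKV : ∀ x ∈ K, x ∈ V := fun x hx =>
    hAV ((Algebra.adjoin K {J}).algebraMap_mem ⟨x, hx⟩)
  exact core_valuation V lam mu2 J (hKV _ hlam) (hKV _ (inv_mem hlam)) (hKV _ hmu)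
    (hKV _ (inv_mem hmu)) hl0 hm0 (hKV _ (inv_mem (by exact_mod_cast natCast_mem K 6)))
    (hV ⟨⟨J, hJA⟩, Ideal.subset_span rfl, rfl⟩) N q hq hdet

def latMat (L : ℕ) : Matrix (ZMod L × ZMod L) (ZMod L × ZMod L) ℤ :=
  Matrix.of fun k l => ((shifts L).map
    (fun d => (if k = l then 1 else 0) - (if k + d = l then 1 else 0))).sum

theorem latMat_mul (L : ℕ) [NeZero L] (q : ZMod L × ZMod L → ℂ) (k : ZMod L × ZMod L) :
    ∑ l, (latMat L k l : ℂ) * q l = ((shifts L).map (fun d => q k - q (k + d))).sum := by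
  simp [latMat, shifts, add_mul, sub_mul, Finset.sum_add_distrib, Finset.sum_sub_distrib]

theorem hess_eq (L : ℕ) [NeZero L] (lam mu2 J : ℂ) (q : ZMod L × ZMod L → ℂ) :
    phi4HessC L lam mu2 J q = Matrix.of fun k l =>
      (if k = l then lam / 2 * q k ^ 2 - mu2 else 0) + J * (latMat L k l : ℂ) := by
  ext k l
  have hp : ∀ i : ZMod L × ZMod L, HasFDerivAt (fun p : ZMod L × ZMod L → ℂ => p i)
      (ContinuousLinearMap.proj (R := ℂ) (φ := fun _ => ℂ) i) q := fun i => hasFDerivAt_apply i q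
  have h := ((((hp k).pow 3).const_mul (lam / 6)).sub ((hp k).const_mul mu2)).add
      ((((hp k).sub (hp (k + (1, 0)))).add (((hp k).sub (hp (k + (-1, 0)))).add
      (((hp k).sub (hp (k + (0, 1)))).add (((hp k).sub (hp (k + (0, -1)))).add
        (hasFDerivAt_const (0 : ℂ) q))))).const_mul J)
  have hf : fderiv ℂ (fun p : ZMod L × ZMod L → ℂ => phi4GradC L lam mu2 J p k) q = _ := h.fderiv
  simp only [phi4HessC, Matrix.of_apply]
  rw [hf]
  simp [latMat, shifts, Pi.single_apply]
  split_ifs <;> ring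

/-- Corollary: for nonzero λ, μ² ∈ ℂ, the union over all lattice sizes L ≥ 2
of the sets of couplings J admitting a singular complex stationary point is countable. -/
theorem phi4_singular_couplings_countable (lam mu2 : ℂ) (hlam : lam ≠ 0) (hmu : mu2 ≠ 0) :
    Set.Countable {J : ℂ | ∃ L : ℕ, ∃ _hL : 2 ≤ L,
      haveI : NeZero L := ⟨by omega⟩
      ∃ q : ZMod L × ZMod L → ℂ,
        (∀ k, phi4GradC L lam mu2 J q k = 0) ∧ (phi4HessC L lam mu2 J q).det = 0} := by
  let K : Subfield ℂ := Subfield.closure {lam, mu2}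
  have hK : Countable K := by
    rw [← Cardinal.mk_le_aleph0_iff]
    refine (Subfield.cardinalMk_closure_le_max _).trans (max_le ?_ le_rfl)
    exact Cardinal.mk_le_aleph0_iff.2 (Set.Countable.to_subtype (by simp))
  refine (Algebraic.countable K ℂ).mono ?_
  rintro J ⟨L, hL, q, hq, hdet⟩
  have : NeZero L := ⟨by omega⟩
  rw [hess_eq] at hdet
  refine core_algebraic K lam mu2 J (Subfield.subset_closure (by simp))
    (Subfield.subset_closure (by simp)) hlam hmu (latMat L) q ?_ hdet
  intro k
  rw [latMat_mul]
  exact hq k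
end

section
/- Let λ, μ² be nonzero rational numbers (viewed inside ℂ) and L ≥ 2 an integer. Then every coupling J belonging to S(L, λ, μ²) — i.e. every J ∈ ℂ for which the L×L φ⁴ model possesses a singular complex stationary point — is an algebraic number (algebraic over ℚ). -/
open scoped BigOperators

open Matrix in
theorem core_aux {K ι : Type*} [Field K] [CharZero K] [Fintype ι] [DecidableEq ι]
    (C : Matrix ι ι ℤ) (q : ι → K) (a m : ℚ) (ha : a ≠ 0) (hm : m ≠ 0) (J : K)
    (hJ : ¬ IsAlgebraic ℚ J)
    (h : ∀ k, (a : K) * q k ^ 3 - (m : K) * q k + J * ∑ l, (C k l : K) * q l = 0) :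
    (Matrix.of fun k l => (if k = l then 3 * (a : K) * q k ^ 2 - (m : K) else 0)
      + J * (C k l : K)).det ≠ 0 := by
  classical
  have hh3 : ∀ B : ValuationSubring K, (((3 : B) : B) : K) = 3 := fun _ => rfl
  have h2' : ∀ B : ValuationSubring K, (((2 : B) : B) : K) = 2 := fun _ => rfl
  let A : Subring K := (Algebra.adjoin ℚ {J}).toSubring
  have hJA : J ∈ A := Algebra.subset_adjoin (by simp)
  let JA : A := ⟨J, hJA⟩
  have hI : (Ideal.span {JA} : Ideal A) ≠ ⊤ := by
    intro hI
    rw [Ideal.span_singleton_eq_top, isUnit_iff_exists_inv] at hI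
    obtain ⟨⟨b, hb⟩, hb1⟩ := hI
    have hb1 : J * b = 1 := congrArg Subtype.val hb1
    have hb : b ∈ Algebra.adjoin ℚ {J} := hb
    rw [Algebra.adjoin_singleton_eq_range_aeval] at hb
    obtain ⟨p, rfl⟩ := hb
    apply hJ
    refine ⟨Polynomial.X * p - 1, ?_, ?_⟩
    · intro h0
      have := congrArg (Polynomial.eval 0) h0
      simp at this
    · simpa [sub_eq_zero] using hb1
  obtain ⟨B, hAB, hIB⟩ := Ideal.image_subset_nonunits_valuationSubring _ hI
  have hrat : ∀ r : ℚ, (r : K) ∈ B := fun r => hAB (by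
    have := (Algebra.adjoin ℚ {J}).algebraMap_mem r
    rw [eq_ratCast] at this
    exact this)
  have hvJ : B.valuation J < 1 := by
    rw [← ValuationSubring.mem_nonunits_iff]
    exact hIB ⟨JA, Ideal.mem_span_singleton_self _, rfl⟩
  have hvr : ∀ r : ℚ, B.valuation (r : K) ≤ 1 := fun r =>
    (B.valuation_le_one_iff _).2 (hrat r)
  have hq : ∀ k, q k ∈ B := by
    intro k0
    obtain ⟨k, -, hk⟩ := Finset.exists_max_image Finset.univ (fun k => B.valuation (q k)) ⟨k0, Finset.mem_univ _⟩
    rw [← B.valuation_le_one_iff]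
    refine (hk k0 (Finset.mem_univ _)).trans ?_
    by_contra! hgt
    have hS : B.valuation (∑ l, (C k l : K) * q l) ≤ B.valuation (q k) := by
      refine Valuation.map_sum_le _ fun l _ => ?_
      rw [map_mul]
      have := hvr (C k l)
      push_cast at this
      exact (mul_le_of_le_one_left' this).trans (hk l (Finset.mem_univ _))
    have ha' : (a : K) ≠ 0 := by exact_mod_cast ha
    have e : q k ^ 3 = ((a⁻¹ : ℚ) : K) * ((m : K) * q k - J * ∑ l, (C k l : K) * q l) := by
      push_cast
      field_simp
      linear_combination h k
    have hle : B.valuation (q k ^ 3) ≤ B.valuation (q k) := by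
      rw [e, map_mul]
      refine (mul_le_of_le_one_left' (hvr _)).trans ?_
      refine (Valuation.map_sub _ _ _).trans (max_le ?_ ?_)
      · rw [map_mul]; exact mul_le_of_le_one_left' (hvr _)
      · rw [map_mul]; exact (mul_le_of_le_one_left' hvJ.le).trans hS
    rw [map_pow] at hle
    have : B.valuation (q k) < B.valuation (q k) ^ 3 := lt_self_pow₀ hgt (by norm_num)
    exact absurd hle (not_le.2 this)
  let Q : ι → B := fun k => ⟨q k, hq k⟩
  let R : ℚ → B := fun r => ⟨(r : K), hrat r⟩
  have hJB : J ∈ B := hAB hJA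
  let JB : B := ⟨J, hJB⟩
  let φ := IsLocalRing.residue B
  have hφJ : φ JB = 0 := by
    rw [IsLocalRing.residue_eq_zero_iff]
    exact (B.valuation_lt_one_iff JB).2 hvJ
  have hRu : ∀ r : ℚ, r ≠ 0 → φ (R r) ≠ 0 := by
    intro r hr h0
    have : R r * R r⁻¹ = 1 := by
      apply Subtype.ext
      have hr' : (r : K) ≠ 0 := by exact_mod_cast hr
      simp [R, hr']
    have := congrArg φ this
    rw [map_mul, h0] at this
    simp at this
  intro hdet
  let M : Matrix ι ι B := Matrix.of fun k l => (if k = l then 3 * R a * Q k ^ 2 - R m else 0)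
      + JB * (C k l : B)
  have hM : M.det = 0 := by
    apply Subtype.val_injective
    have := B.subtype.map_det M
    refine this.trans (Eq.trans ?_ hdet)
    congr 1
    ext k l
    by_cases hkl : k = l <;> simp [M, hkl, R, Q, JB, hh3]
  have h2 := φ.map_det M
  rw [hM, map_zero] at h2
  have h3 : φ.mapMatrix M = Matrix.diagonal fun k => φ (3 * R a * Q k ^ 2 - R m) := by
    ext k l
    by_cases hkl : k = l
    · subst hkl; simp [M, hφJ]
    · simp [M, hφJ, hkl]
  rw [h3, Matrix.det_diagonal, eq_comm, Finset.prod_eq_zero_iff] at h2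
  obtain ⟨k, -, hk⟩ := h2
  have hB : R a * Q k ^ 3 - R m * Q k + JB * ∑ l, (C k l : B) * Q l = 0 := by
    apply Subtype.val_injective
    have := h k
    simpa [R, Q, JB] using this
  have hB := congrArg φ hB
  simp only [map_sub, map_add, map_mul, map_pow, hφJ, zero_mul, add_zero, map_zero, map_ofNat] at hB hk
  have h2R : φ (2 * R m) ≠ 0 := by
    have : 2 * R m = R (2 * m) := by
      apply Subtype.ext
      simp [R, h2']
    rw [this]
    exact hRu _ (by simpa using hm)
  have h5 : φ (2 * R m) * φ (Q k) = 0 := by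
    rw [map_mul, map_ofNat]
    linear_combination φ (Q k) * hk - 3 * hB
  have h6 := (mul_eq_zero.1 h5).resolve_left h2R
  rw [h6] at hk
  exact hRu m hm (by simpa using hk)

/-- for nonzero rational λ, μ² (viewed in ℂ), every coupling J ∈ ℂ for which
the φ⁴ model possesses a singular complex stationary point is algebraic over ℚ. -/
theorem phi4_singular_coupling_algebraic (L : ℕ) [NeZero L] (hL : 2 ≤ L)
    (lam mu2 : ℚ) (hlam : lam ≠ 0) (hmu : mu2 ≠ 0) (J : ℂ)
    (hJ : ∃ q : ZMod L × ZMod L → ℂ,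
      (∀ k, phi4GradC L (lam : ℂ) (mu2 : ℂ) J q k = 0) ∧
        (phi4HessC L (lam : ℂ) (mu2 : ℂ) J q).det = 0) :
    IsAlgebraic ℚ J := by
  obtain ⟨q, hg, hd⟩ := hJ
  by_contra hJ
  let C : Matrix (ZMod L × ZMod L) (ZMod L × ZMod L) ℤ := fun k l =>
    ((shifts L).map (fun d => (if k = l then 1 else 0) - if k + d = l then 1 else 0)).sum
  refine core_aux C q (lam / 6) mu2 (by simpa using hlam) hmu J hJ ?_ ?_
  · intro k
    rw [← hg k]
    simp [phi4GradC, C, shifts, sub_mul, add_mul, Finset.sum_add_distrib]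
  · refine Eq.trans ?_ hd
    congr 1
    ext k l
    have hp : ∀ i : ZMod L × ZMod L, HasFDerivAt (𝕜 := ℂ) (fun p : ZMod L × ZMod L → ℂ => p i)
      (ContinuousLinearMap.proj i) q := fun i => hasFDerivAt_apply i q
    have H := ((((hp k).pow 3).const_mul ((lam : ℂ) / 6)).sub ((hp k).const_mul (mu2 : ℂ))).add
      ((((hp k).sub (hp (k + (1, 0)))).add (((hp k).sub (hp (k + (-1, 0)))).add
        (((hp k).sub (hp (k + (0, 1)))).add ((hp k).sub (hp (k + (0, -1))))))).const_mul J)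
    have H2 := H.congr_of_eventuallyEq (f₁ := fun p : ZMod L × ZMod L → ℂ =>
        phi4GradC L lam mu2 J p k) (Filter.Eventually.of_forall fun p => by
      simp [phi4GradC, shifts])
    simp only [phi4HessC, Matrix.of_apply]
    rw [H2.fderiv]
    simp [C, shifts, Pi.single_apply]
    split_ifs <;> ring
end

section
/- Let L ≥ 3, λ > 0, μ² > 0, and suppose J > μ² / (2(1 − cos(2π/L))). Then the Hessian H_V(0) of the φ⁴ potential at the zero configuration has exactly one negative eigenvalue (counted with multiplicity), i.e. the stationary point q ≡ 0 has index 1. -/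
open scoped BigOperators

lemma phi4_hess_entry (L : ℕ) [NeZero L] (lam mu2 J : ℝ) (k l : ZMod L × ZMod L) :
    phi4Hess L lam mu2 J (fun _ => 0) k l =
      - mu2 * (Pi.single l 1 : ZMod L × ZMod L → ℝ) k
      + J * ((shifts L).map (fun d => (Pi.single l 1 : ZMod L × ZMod L → ℝ) k
        - (Pi.single l 1 : ZMod L × ZMod L → ℝ) (k + d))).sum := by
  have hp : ∀ j : ZMod L × ZMod L, HasFDerivAt (fun p : ZMod L × ZMod L → ℝ => p j)
      (ContinuousLinearMap.proj (R := ℝ) (φ := fun _ : ZMod L × ZMod L => ℝ) j)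
      (fun _ => (0 : ℝ)) := fun j => hasFDerivAt_apply j _
  unfold phi4Hess
  rw [Matrix.of_apply]
  simp only [phi4Grad, shifts, List.map_cons, List.map_nil, List.sum_cons, List.sum_nil]
  have h := ((((hp k).pow 3).const_mul (lam / 6)).sub ((hp k).const_mul mu2)).add
    ((((hp k).sub (hp (k + (1, 0)))).add (((hp k).sub (hp (k + (-1, 0)))).add
      (((hp k).sub (hp (k + (0, 1)))).add (((hp k).sub (hp (k + (0, -1)))).add
        (hasFDerivAt_const (0 : ℝ) _))))).const_mul J)
  have h2 := h.fderiv
  have h3 := congrArg (fun T => T (Pi.single l 1)) h2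
  refine Eq.trans h3 ?_
  simp
  ring

lemma phi4_cos_le (L : ℕ) (hL : 3 ≤ L) (v : ℕ) (hv : 1 ≤ v) (hvL : v < L) :
    Real.cos (2 * Real.pi * v / L) ≤ Real.cos (2 * Real.pi / L) := by
  have hpi := Real.pi_pos
  have hL0 : (0 : ℝ) < L := by positivity
  have key : ∀ w : ℕ, 1 ≤ w → 2 * w ≤ L →
      Real.cos (2 * Real.pi * w / L) ≤ Real.cos (2 * Real.pi / L) := by
    intro w hw hw2
    have h1 : (1 : ℝ) ≤ w := by exact_mod_cast hw
    have h2 : 2 * (w : ℝ) ≤ L := by exact_mod_cast hw2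
    apply Real.cos_le_cos_of_nonneg_of_le_pi
    · positivity
    · rw [div_le_iff₀ hL0]; nlinarith
    · apply div_le_div_of_nonneg_right _ hL0.le; nlinarith
  by_cases h : 2 * v ≤ L
  · exact key v hv h
  · have := key (L - v) (by omega) (by omega)
    rw [Nat.cast_sub hvL.le] at this
    have e : 2 * Real.pi * ((L : ℝ) - v) / L = 2 * Real.pi - 2 * Real.pi * v / L := by
      field_simp
    rwa [e, Real.cos_two_pi_sub] at this

lemma phi4_char_re (L : ℕ) [NeZero L] (a : ZMod L) :
    (ZMod.stdAddChar a).re = Real.cos (2 * Real.pi * a.val / L) := by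
  have h := ZMod.stdAddChar_coe (N := L) (a.val : ℤ)
  have e : (((a.val : ℤ)) : ZMod L) = a := by simp
  rw [e] at h
  rw [h, ← Complex.exp_ofReal_mul_I_re]
  congr 2
  push_cast
  ring

lemma phi4_char_add_neg (L : ℕ) [NeZero L] (a : ZMod L) :
    ZMod.stdAddChar a + ZMod.stdAddChar (-a) = ((2 * (ZMod.stdAddChar a).re : ℝ) : ℂ) := by
  rw [AddChar.map_neg_eq_conj, Complex.add_conj]

/-- Character matrix. -/
noncomputable def phi4F (L : ℕ) [NeZero L] :
    Matrix (ZMod L × ZMod L) (ZMod L × ZMod L) ℂ :=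
  Matrix.of fun k l => ZMod.stdAddChar (k.1 * l.1 + k.2 * l.2)

/-- Inverse character matrix up to scale. -/
noncomputable def phi4G (L : ℕ) [NeZero L] :
    Matrix (ZMod L × ZMod L) (ZMod L × ZMod L) ℂ :=
  Matrix.of fun k l => ZMod.stdAddChar (-(k.1 * l.1 + k.2 * l.2))

/-- Eigenvalues. -/
noncomputable def phi4ev (L : ℕ) [NeZero L] (mu2 J : ℝ) (l : ZMod L × ZMod L) : ℝ :=
  -mu2 + J * (4 - 2 * (ZMod.stdAddChar l.1).re - 2 * (ZMod.stdAddChar l.2).re)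

lemma phi4_FG (L : ℕ) [NeZero L] : phi4F L * phi4G L = ((L : ℂ) * L) • 1 := by
  ext k l
  have hp := ZMod.isPrimitive_stdAddChar L
  rw [Matrix.mul_apply, Fintype.sum_prod_type]
  have h : ∀ x y : ZMod L, phi4F L k (x, y) * phi4G L (x, y) l =
      ZMod.stdAddChar (x * (k.1 - l.1)) * ZMod.stdAddChar (y * (k.2 - l.2)) := by
    intro x y
    simp only [phi4F, phi4G, Matrix.of_apply]
    rw [← AddChar.map_add_eq_mul, ← AddChar.map_add_eq_mul]
    congr 1
    ring
  simp only [h]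
  rw [← Finset.sum_mul_sum, AddChar.sum_mulShift _ hp, AddChar.sum_mulShift _ hp]
  simp only [Matrix.smul_apply, Matrix.one_apply, Prod.ext_iff, sub_eq_zero, ZMod.card]
  by_cases h1 : k.1 = l.1 <;> by_cases h2 : k.2 = l.2 <;> simp [h1, h2]

lemma phi4_HF (L : ℕ) [NeZero L] (lam mu2 J : ℝ) :
    (phi4Hess L lam mu2 J (fun _ => 0)).map (algebraMap ℝ ℂ) * phi4F L
      = phi4F L * Matrix.diagonal (fun l => ((phi4ev L mu2 J l : ℝ) : ℂ)) := by
  ext k l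
  rw [Matrix.mul_diagonal, Matrix.mul_apply]
  have hs : ∀ j : ZMod L × ZMod L, ∑ x, ((Pi.single x 1 : ZMod L × ZMod L → ℝ) j : ℂ) *
      phi4F L x l = phi4F L j l := by
    intro j
    rw [Finset.sum_eq_single j]
    · simp
    · intro b _ hb
      simp [Pi.single_apply, hb.symm]
    · simp
  have e : ∀ x, ((phi4Hess L lam mu2 J (fun _ => 0)).map (algebraMap ℝ ℂ)) k x * phi4F L x l =
      (-mu2 + 4 * J) * (((Pi.single x 1 : ZMod L × ZMod L → ℝ) k : ℂ) * phi4F L x l)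
      - J * (((Pi.single x 1 : ZMod L × ZMod L → ℝ) (k + (1, 0)) : ℂ) * phi4F L x l)
      - J * (((Pi.single x 1 : ZMod L × ZMod L → ℝ) (k + (-1, 0)) : ℂ) * phi4F L x l)
      - J * (((Pi.single x 1 : ZMod L × ZMod L → ℝ) (k + (0, 1)) : ℂ) * phi4F L x l)
      - J * (((Pi.single x 1 : ZMod L × ZMod L → ℝ) (k + (0, -1)) : ℂ) * phi4F L x l) := by
    intro x
    rw [Matrix.map_apply, phi4_hess_entry]
    simp only [shifts, List.map_cons, List.map_nil, List.sum_cons, List.sum_nil,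
      Complex.coe_algebraMap]
    push_cast
    ring
  simp only [e, Finset.sum_sub_distrib, ← Finset.mul_sum, hs]
  have hsh : ∀ d : ZMod L × ZMod L, phi4F L (k + d) l =
      phi4F L k l * ZMod.stdAddChar (d.1 * l.1 + d.2 * l.2) := by
    intro d
    simp only [phi4F, Matrix.of_apply]
    rw [← AddChar.map_add_eq_mul]
    congr 1
    simp only [Prod.fst_add, Prod.snd_add]
    ring
  simp only [hsh]
  have h1 := phi4_char_add_neg L l.1
  have h2 := phi4_char_add_neg L l.2
  simp only [one_mul, zero_mul, add_zero, zero_add, neg_mul]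
  unfold phi4ev
  push_cast at h1 h2 ⊢
  linear_combination (-J * phi4F L k l) * (h1 + h2)

lemma phi4_charpoly (L : ℕ) [NeZero L] (lam mu2 J : ℝ) :
    (phi4Hess L lam mu2 J (fun _ => 0)).charpoly =
      ∏ l, (Polynomial.X - Polynomial.C (phi4ev L mu2 J l)) := by
  apply Polynomial.map_injective (algebraMap ℝ ℂ) (algebraMap ℝ ℂ).injective
  rw [← Matrix.charpoly_map]
  have hN : ((L : ℂ) * L) ≠ 0 := by
    have := NeZero.ne L
    simp [this]
  have hu : IsUnit (phi4F L) := by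
    apply IsUnit.of_mul_eq_one (((L : ℂ) * L)⁻¹ • phi4G L)
    rw [Matrix.mul_smul, phi4_FG, smul_smul, inv_mul_cancel₀ hN, one_smul]
  obtain ⟨U, hU⟩ := hu
  have hH := phi4_HF L lam mu2 J
  rw [← hU] at hH
  have hH2 : (phi4Hess L lam mu2 J (fun _ => 0)).map (algebraMap ℝ ℂ) =
      U.val * Matrix.diagonal (fun l => ((phi4ev L mu2 J l : ℝ) : ℂ)) * U⁻¹.val := by
    rw [← hH, mul_assoc, Units.mul_inv, mul_one]
  rw [hH2, Matrix.coe_units_inv, Matrix.charpoly_units_conj, Matrix.charpoly_diagonal, Polynomial.map_prod]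
  simp

/-- for L ≥ 3, λ, μ² > 0 and J > μ²/(2(1 − cos(2π/L))), the Hessian of V at
the zero configuration has exactly one negative eigenvalue counted with multiplicity
(the roots of its characteristic polynomial being its eigenvalues with multiplicity),
i.e. the stationary point q ≡ 0 has index 1. -/
theorem phi4_zero_config_index_one (L : ℕ) [NeZero L] (hL : 3 ≤ L) (lam mu2 J : ℝ)
    (hlam : 0 < lam) (hmu : 0 < mu2)
    (hJ : mu2 / (2 * (1 - Real.cos (2 * Real.pi / (L : ℝ)))) < J) :
    (((phi4Hess L lam mu2 J (fun _ => 0)).charpoly.roots).filter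
      (fun x => x < 0)).card = 1 := by
  have hr : (phi4Hess L lam mu2 J (fun _ => 0)).charpoly.roots =
      (Finset.univ.val).map (phi4ev L mu2 J) := by
    rw [phi4_charpoly]
    exact Polynomial.roots_multiset_prod_X_sub_C (Finset.univ.val.map (phi4ev L mu2 J)) ▸ by
      rw [Multiset.map_map]; rfl
  have hL3 : (3 : ℝ) ≤ L := by exact_mod_cast hL
  have hL0 : (0 : ℝ) < L := by linarith
  have hpi := Real.pi_pos
  have hc1 : Real.cos (2 * Real.pi / L) < 1 := by
    rw [← Real.cos_zero]
    apply Real.cos_lt_cos_of_nonneg_of_le_pi le_rfl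
    · rw [div_le_iff₀ hL0]; nlinarith
    · positivity
  set c := Real.cos (2 * Real.pi / L) with hc
  have hJ2 : mu2 < J * (2 * (1 - c)) := by
    rwa [div_lt_iff₀ (by linarith)] at hJ
  have hJ0 : 0 < J := lt_of_le_of_lt (div_nonneg hmu.le (by linarith)) hJ
  have hle : ∀ a : ZMod L, (ZMod.stdAddChar a).re ≤ 1 := fun a => by
    rw [phi4_char_re]; exact Real.cos_le_one _
  have hlt : ∀ a : ZMod L, a ≠ 0 → (ZMod.stdAddChar a).re ≤ c := fun a ha => by
    rw [phi4_char_re]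
    exact phi4_cos_le L hL _ (Nat.one_le_iff_ne_zero.2 (by simpa using ha)) (ZMod.val_lt a)
  have hev : ∀ l : ZMod L × ZMod L, phi4ev L mu2 J l < 0 ↔ l = 0 := by
    rintro ⟨a, b⟩
    constructor
    · intro h
      by_contra hne
      have hab : (ZMod.stdAddChar a).re + (ZMod.stdAddChar b).re ≤ 1 + c := by
        by_cases ha : a = 0
        · have hb : b ≠ 0 := fun hb => hne (by rw [ha, hb]; rfl)
          linarith [hle a, hlt b hb]
        · linarith [hle b, hlt a ha]
      unfold phi4ev at h
      simp only at h
      nlinarith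
    · intro h
      rw [h]
      simp [phi4ev]
      linarith
  rw [hr, Multiset.filter_map, Multiset.card_map]
  have : (Multiset.filter ((fun x => x < 0) ∘ phi4ev L mu2 J)
      (Finset.univ : Finset (ZMod L × ZMod L)).val) = {0} := by
    have : (Finset.univ : Finset (ZMod L × ZMod L)).filter
        ((fun x => x < 0) ∘ phi4ev L mu2 J) = {0} := by
      ext l; simp [hev]
    exact congrArg Finset.val this
  rw [this]
  simp
end

section
/- Let λ > 0, μ² > 0, J ≥ 0 and v > 0. Then the sublevel set M_v = { q : Λ → ℝ | V(q) ≤ N v }, where N = L², is homeomorphic to the closed unit ball of ℝ^N; in particular M_v is a contractible compact subset of configuration space. -/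
open scoped BigOperators

theorem star_ball_aux {E F : Type*} [NormedAddCommGroup E] [NormedSpace ℝ E]
    [NormedAddCommGroup F] [NormedSpace ℝ F] (e : E ≃L[ℝ] F) (g : E → ℝ)
    (hg : Continuous g) (hg0 : ∀ x, x ≠ 0 → 0 < g x)
    (hgs : ∀ (t : ℝ) x, 0 ≤ t → g (t • x) = t * g x)
    (M : Set E) (hM : ∀ x, x ∈ M ↔ g x ≤ 1) (hc : IsCompact M) :
    Nonempty (M ≃ₜ Metric.closedBall (0 : F) 1) := by
  have gz : g 0 = 0 := by simpa using hgs 0 0 le_rfl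
  have gnn : ∀ x, 0 ≤ g x := fun x => by
    by_cases h : x = 0
    · rw [h, gz]
    · exact (hg0 x h).le
  have hne : ∀ x, x ≠ 0 → 0 < ‖e x‖ := fun x hx => by simpa using hx
  have hns : ∀ y : F, y ≠ 0 → e.symm y ≠ 0 := fun y hy => by simpa using hy
  let f : E → F := fun x => (g x / ‖e x‖) • e x
  let k : F → E := fun y => (‖y‖ / g (e.symm y)) • e.symm y
  have hf0 : f 0 = 0 := by simp [f]
  have hk0 : k 0 = 0 := by simp [k]
  have hfn : ∀ x, ‖f x‖ = g x := fun x => by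
    by_cases h : x = 0
    · rw [h, hf0, gz, norm_zero]
    · simp only [f, norm_smul, Real.norm_eq_abs]
      have := hne x h
      rw [abs_of_nonneg (div_nonneg (gnn x) this.le)]
      field_simp
  have hgk : ∀ y, g (k y) = ‖y‖ := fun y => by
    by_cases h : y = 0
    · rw [h, hk0, gz, norm_zero]
    · have := hg0 _ (hns y h)
      simp only [k]
      rw [hgs _ _ (div_nonneg (norm_nonneg _) this.le)]
      field_simp
  have hkf : ∀ x, k (f x) = x := fun x => by
    by_cases h : x = 0
    · rw [h, hf0, hk0]
    · have h1 := hne x h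
      have h2 := hg0 x h
      have h3 : e.symm (f x) = (g x / ‖e x‖) • x := by simp [f]
      simp only [k]
      rw [hfn, h3, hgs _ _ (by positivity), smul_smul]
      have : g x / (g x / ‖e x‖ * g x) * (g x / ‖e x‖) = 1 := by field_simp
      rw [this, one_smul]
  have hfk : ∀ y, f (k y) = y := fun y => by
    by_cases h : y = 0
    · rw [h, hk0, hf0]
    · have h1 : 0 < ‖y‖ := norm_pos_iff.mpr h
      have h2 := hg0 _ (hns y h)
      have h3 : e (k y) = (‖y‖ / g (e.symm y)) • y := by simp [k]
      simp only [f]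
      rw [hgk, h3, norm_smul, smul_smul, Real.norm_eq_abs, abs_of_pos (by positivity)]
      have : ‖y‖ / (‖y‖ / g (e.symm y) * ‖y‖) * (‖y‖ / g (e.symm y)) = 1 := by field_simp
      rw [this, one_smul]
  have hfc : Continuous f := by
    rw [continuous_iff_continuousAt]
    intro x
    by_cases h : x = 0
    · subst h
      rw [ContinuousAt, hf0, tendsto_zero_iff_norm_tendsto_zero]
      simp only [hfn]
      simpa [gz] using hg.tendsto 0
    · exact (hg.continuousAt.div e.continuous.norm.continuousAt (hne x h).ne').smul
        e.continuous.continuousAt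
  haveI : CompactSpace M := isCompact_iff_compactSpace.mp hc
  let eq : M ≃ Metric.closedBall (0 : F) 1 :=
    { toFun := fun x => ⟨f x, by simpa [hfn] using (hM x).1 x.2⟩
      invFun := fun y => ⟨k y, by rw [hM, hgk]; exact mem_closedBall_zero_iff.mp y.2⟩
      left_inv := fun x => Subtype.ext (hkf x)
      right_inv := fun y => Subtype.ext (hfk y) }
  have hec : Continuous eq := (hfc.comp continuous_subtype_val).subtype_mk _
  exact ⟨hec.homeoOfEquivCompactToT2⟩

theorem gauge_pos_aux {a b c : ℝ} (ha : 0 < a) (hc : 0 < c) :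
    0 < b + Real.sqrt (b ^ 2 + 4 * a * c) := by
  have : |b| < Real.sqrt (b ^ 2 + 4 * a * c) := by
    apply Real.lt_sqrt_of_sq_lt
    rw [sq_abs]
    have := mul_pos ha hc
    linarith
  linarith [neg_abs_le b]

theorem gauge_le_aux {a b c : ℝ} (ha : 0 ≤ a) (hc : 0 < c) :
    a + b ≤ c ↔ Real.sqrt ((b + Real.sqrt (b ^ 2 + 4 * a * c)) / (2 * c)) ≤ 1 := by
  rw [Real.sqrt_le_iff, and_iff_right zero_le_one, one_pow, div_le_one (by positivity)]
  have hac := mul_nonneg ha hc.le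
  constructor
  · intro h
    have : Real.sqrt (b ^ 2 + 4 * a * c) ≤ 2 * c - b := by
      apply Real.sqrt_le_iff.mpr
      constructor
      · linarith
      · nlinarith
    linarith
  · intro h
    have h1 : Real.sqrt (b ^ 2 + 4 * a * c) ≤ 2 * c - b := by linarith
    have h2 := (Real.sqrt_le_iff.mp h1).2
    have : c * (a + b) ≤ c * c := by nlinarith
    exact le_of_mul_le_mul_left this hc

/-- for λ, μ² > 0, J ≥ 0 and v > 0, the sublevel set
M_v = {q | V(q) ≤ N v} is homeomorphic to the closed unit ball of ℝ^N; in particular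
it is a compact, contractible subset of configuration space. -/
theorem phi4_sublevel_set_ball (L : ℕ) [NeZero L] (hL : 2 ≤ L) (lam mu2 J v : ℝ)
    (hlam : 0 < lam) (hmu : 0 < mu2) (hJ : 0 ≤ J) (hv : 0 < v) :
    Nonempty ({q : ZMod L × ZMod L → ℝ | phi4V L lam mu2 J q ≤ (L ^ 2 : ℝ) * v} ≃ₜ
      (Metric.closedBall (0 : EuclideanSpace ℝ (Fin (L ^ 2))) 1)) ∧
    IsCompact {q : ZMod L × ZMod L → ℝ | phi4V L lam mu2 J q ≤ (L ^ 2 : ℝ) * v} ∧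
    ContractibleSpace {q : ZMod L × ZMod L → ℝ | phi4V L lam mu2 J q ≤ (L ^ 2 : ℝ) * v} := by
  classical
  have hLpos : (0 : ℝ) < L := by exact_mod_cast (by omega : 0 < L)
  set c : ℝ := (L ^ 2 : ℝ) * v with hcdef
  have hc : 0 < c := by positivity
  let A : (ZMod L × ZMod L → ℝ) → ℝ := fun q => ∑ i, lam / 24 * q i ^ 4
  let B : (ZMod L × ZMod L → ℝ) → ℝ := fun q => ∑ i : ZMod L × ZMod L,
    (- (mu2 / 2 * q i ^ 2) + J / 4 * ((q i - q (i + (1, 0))) ^ 2 + ((q i - q (i + (-1, 0))) ^ 2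
      + ((q i - q (i + (0, 1))) ^ 2 + (q i - q (i + (0, -1))) ^ 2))))
  have hV : ∀ q, phi4V L lam mu2 J q = A q + B q := fun q => by
    simp only [A, B, phi4V, shifts, ← Finset.sum_add_distrib]
    refine Finset.sum_congr rfl fun i _ => ?_
    simp only [List.map_cons, List.map_nil, List.sum_cons, List.sum_nil]
    ring
  have hAc : Continuous A := by fun_prop
  have hBc : Continuous B := by fun_prop
  have hAs : ∀ (t : ℝ) q, A (t • q) = t ^ 4 * A q := fun t q => by
    simp only [A, Finset.mul_sum, Pi.smul_apply, smul_eq_mul]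
    exact Finset.sum_congr rfl fun i _ => by ring
  have hBs : ∀ (t : ℝ) q, B (t • q) = t ^ 2 * B q := fun t q => by
    simp only [B, Finset.mul_sum, Pi.smul_apply, smul_eq_mul]
    exact Finset.sum_congr rfl fun i _ => by ring
  have hA0 : ∀ q, 0 ≤ A q := fun q => Finset.sum_nonneg fun i _ => by positivity
  have hAp : ∀ q, q ≠ 0 → 0 < A q := fun q hq => by
    obtain ⟨i, hi⟩ := Function.ne_iff.mp hq
    simp only [Pi.zero_apply] at hi
    exact Finset.sum_pos' (fun i _ => by positivity) ⟨i, Finset.mem_univ i, by positivity⟩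
  have hcomp : IsCompact {q : ZMod L × ZMod L → ℝ | phi4V L lam mu2 J q ≤ c} := by
    apply Metric.isCompact_of_isClosed_isBounded
    · simp only [hV]
      exact isClosed_le (hAc.add hBc) continuous_const
    · let K : ℝ := 6 * (mu2 / 2 + 1) ^ 2 / lam
      have hK : ∀ x : ℝ, x ^ 2 - K ≤ lam / 24 * x ^ 4 - mu2 / 2 * x ^ 2 := fun x => by
        have : lam / 24 * x ^ 4 - mu2 / 2 * x ^ 2 - (x ^ 2 - K)
            = lam / 24 * (x ^ 2 - 12 * (mu2 / 2 + 1) / lam) ^ 2 := by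
          simp only [K]; field_simp; ring
        have h2 : 0 ≤ lam / 24 * (x ^ 2 - 12 * (mu2 / 2 + 1) / lam) ^ 2 := by positivity
        linarith
      let R : ℝ := c + ∑ _i : ZMod L × ZMod L, K
      refine (Metric.isBounded_closedBall (x := 0) (r := Real.sqrt R)).subset fun q hq => ?_
      have h1 : ∑ i, (q i ^ 2 - K) ≤ phi4V L lam mu2 J q := by
        rw [hV]
        simp only [A, B, ← Finset.sum_add_distrib]
        refine Finset.sum_le_sum fun i _ => ?_
        have h3 : 0 ≤ J / 4 * ((q i - q (i + (1, 0))) ^ 2 + ((q i - q (i + (-1, 0))) ^ 2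
          + ((q i - q (i + (0, 1))) ^ 2 + (q i - q (i + (0, -1))) ^ 2))) := by positivity
        linarith [hK (q i)]
      rw [Finset.sum_sub_distrib] at h1
      have h2 : ∑ i, q i ^ 2 ≤ R := by
        have : phi4V L lam mu2 J q ≤ c := hq
        simp only [R]; linarith
      rw [mem_closedBall_zero_iff, pi_norm_le_iff_of_nonneg (Real.sqrt_nonneg _)]
      intro i
      rw [Real.norm_eq_abs]
      apply Real.abs_le_sqrt
      exact (Finset.single_le_sum (f := fun i => q i ^ 2) (fun j _ => sq_nonneg _)
        (Finset.mem_univ i)).trans h2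
  let g : (ZMod L × ZMod L → ℝ) → ℝ := fun q =>
    Real.sqrt ((B q + Real.sqrt (B q ^ 2 + 4 * A q * c)) / (2 * c))
  let e : (ZMod L × ZMod L → ℝ) ≃L[ℝ] EuclideanSpace ℝ (Fin (L ^ 2)) :=
    ContinuousLinearEquiv.ofFinrankEq (by
      simp [ZMod.card, sq])
  have hhom := star_ball_aux e g (by fun_prop)
    (fun q hq => Real.sqrt_pos.mpr (div_pos (gauge_pos_aux (hAp q hq) hc) (by positivity)))
    (fun t q ht => by
      simp only [g, hAs, hBs]
      have h1 : (t ^ 2 * B q) ^ 2 + 4 * (t ^ 4 * A q) * c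
          = (t ^ 2) ^ 2 * (B q ^ 2 + 4 * A q * c) := by ring
      rw [h1, Real.sqrt_mul (by positivity), Real.sqrt_sq (by positivity), ← mul_add,
        mul_div_assoc, Real.sqrt_mul (by positivity), Real.sqrt_sq ht])
    {q | phi4V L lam mu2 J q ≤ c}
    (fun q => by
      rw [Set.mem_setOf_eq, hV]
      exact gauge_le_aux (hA0 q) hc) hcomp
  refine ⟨hhom, hcomp, ?_⟩
  obtain ⟨h⟩ := hhom
  haveI : ContractibleSpace (Metric.closedBall (0 : EuclideanSpace ℝ (Fin (L ^ 2))) 1) :=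
    (convex_closedBall _ _).contractibleSpace ⟨0, by simp⟩
  exact h.contractibleSpace
end
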